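/- Let K be a field of characteristic zero, let a1 ∈ K be a constant, let a0(x), a2(x) ∈ K[x], and let D = y∂x + (a2(x)y² + a1·y + a0(x))∂y be the K-derivation of K[x,y]. Then D is simple if and only if a0(x) is a nonzero constant (a0(x) ∈ K*) and deg a2(x) ≥ 1. -/

import Mathlib

/-- A `K`-derivation `D` of `R` is *simple* if `R` has no `D`-stable ideal
other than `0` and `R`. -/
def Derivation.IsSimple {K R : Type*} [CommRing K] [CommRing R] [Algebra K R]
    (D : Derivation K R R) : Prop :=
  ∀ I : Ideal R, (∀ a ∈ I, D a ∈ I) → I = ⊥ ∨ I = ⊤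


section DifferentialIdeals

variable {K R S : Type*} [Field K] [CommRing R] [Algebra K R] [CommRing S] [Algebra K S]

theorem Derivation.IsSimple.of_ringEquiv {D : Derivation K R R} (hD : D.IsSimple)
    {D' : Derivation K S S} (e : R ≃+* S) (he : ∀ a, e (D a) = D' (e a)) : D'.IsSimple := by
  intro I hI
  have hstable : ∀ a ∈ I.comap e, D a ∈ I.comap e := by
    intro a ha
    rw [Ideal.mem_comap] at ha ⊢
    rw [he]
    exact hI _ ha
  have hmap : (I.comap e).map e = I := Ideal.map_comap_of_surjective e e.surjective I
  rcases hD _ hstable with h | h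
  · left
    rw [← hmap, h, Ideal.map_bot]
  · right
    rw [← hmap, h, Ideal.map_top]

theorem Derivation.exists_pow_mem_of_pow_mul_pow_mem [CharZero K] (D : Derivation K R R)
    {I : Ideal R} (hI : ∀ a ∈ I, D a ∈ I) (a : R) (m t : ℕ) (h : a ^ m * D a ^ t ∈ I) :
    ∃ s, D a ^ s ∈ I := by
  induction m generalizing t with
  | zero => exact ⟨t, by simpa using h⟩
  | succ m ih =>
    refine ih (t + 2) ?_
    have h1 := I.mul_mem_left (D a) (hI _ h)
    have h2 := I.mul_mem_left (t * D (D a)) h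
    have h3 : ((m + 1 : ℕ) : K) • (a ^ m * D a ^ (t + 2)) ∈ I := by
      convert I.sub_mem h1 h2 using 1
      rcases t with _ | t
      · simp [Algebra.smul_def]
        ring
      · simp [Algebra.smul_def]
        ring
    have h4 : ((m + 1 : ℕ) : K) ≠ 0 := Nat.cast_ne_zero.mpr m.succ_ne_zero
    have h5 := Submodule.smul_of_tower_mem I (((m + 1 : ℕ) : K)⁻¹) h3
    rwa [smul_smul, inv_mul_cancel₀ h4, one_smul] at h5

theorem Derivation.radical_stable [CharZero K] (D : Derivation K R R)
    {I : Ideal R} (hI : ∀ a ∈ I, D a ∈ I) : ∀ a ∈ I.radical, D a ∈ I.radical := by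
  rintro a ⟨n, hn⟩
  exact D.exists_pow_mem_of_pow_mul_pow_mem hI a n 0 (by simpa using hn)

theorem Derivation.exists_stable_prime [CharZero K] [IsNoetherianRing R] (D : Derivation K R R)
    (hD : ¬ D.IsSimple) : ∃ P : Ideal R, P.IsPrime ∧ P ≠ ⊥ ∧ ∀ a ∈ P, D a ∈ P := by
  simp only [Derivation.IsSimple, not_forall, not_or] at hD
  obtain ⟨I, hI, hbot, htop⟩ := hD
  obtain ⟨P, ⟨hP, hPbot, hPtop⟩, hmax⟩ := set_has_maximal_iff_noetherian.mpr
    (inferInstance : IsNoetherian R R) {J : Ideal R | (∀ a ∈ J, D a ∈ J) ∧ J ≠ ⊥ ∧ J ≠ ⊤}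
    ⟨I, hI, hbot, htop⟩
  have key : ∀ J : Ideal R, (∀ a ∈ J, D a ∈ J) → P ≤ J → J ≠ ⊤ → J = P := by
    intro J hJ hle hne
    by_contra hneq
    refine hmax J ⟨hJ, ?_, hne⟩ (lt_of_le_of_ne hle (Ne.symm hneq))
    rintro rfl
    exact hPbot (le_bot_iff.mp hle)
  have hrad : Ideal.radical P = P :=
    key _ (D.radical_stable hP) Ideal.le_radical (by rwa [Ne, Ideal.radical_eq_top])
  have hmul : ∀ a b, a * b ∈ P → a * D b ∈ P := by
    intro a b hab
    rw [← hrad]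
    refine ⟨2, ?_⟩
    have h1 := Ideal.mul_mem_left P (a * D b) (hP _ hab)
    have h2 := Ideal.mul_mem_left P (D b * D a) hab
    convert Ideal.sub_mem P h1 h2 using 1
    simp
    ring
  refine ⟨P, ⟨hPtop, ?_⟩, hPbot, hP⟩
  intro a b hab
  by_contra! hcon
  have hcolon : ∀ x, x ∈ P.comap (LinearMap.mulLeft R a) ↔ a * x ∈ P := fun x => Iff.rfl
  have := key (P.comap (LinearMap.mulLeft R a)) (fun x hx => hmul a x hx)
    (fun x hx => Ideal.mul_mem_left P a hx)
    (fun h => hcon.1 (by simpa using (hcolon 1).mp (h ▸ Submodule.mem_top)))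
  exact hcon.2 (this ▸ (hcolon b).mpr hab)

theorem Derivation.span_stable (D : Derivation K R R) {s : Set R}
    (hs : ∀ x ∈ s, D x ∈ Ideal.span s) : ∀ x ∈ Ideal.span s, D x ∈ Ideal.span s := by
  intro x hx
  induction hx using Submodule.span_induction with
  | mem x hx => exact hs x hx
  | zero => simp
  | add x y _ _ hx hy =>
    rw [map_add]
    exact Ideal.add_mem _ hx hy
  | smul r x hx' hx =>
    rw [smul_eq_mul, D.leibniz]
    exact Ideal.add_mem _ (Ideal.mul_mem_left _ _ hx) (Ideal.mul_mem_right _ _ hx')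

theorem Derivation.IsSimple.eq_zero_or_isUnit {D : Derivation K R R} (hD : D.IsSimple) {g : R}
    (hg : g ∣ D g) : g = 0 ∨ IsUnit g := by
  have h := hD (Ideal.span {g}) (D.span_stable (by simpa [Ideal.mem_span_singleton] using hg))
  rwa [Ideal.span_singleton_eq_bot, Ideal.span_singleton_eq_top] at h

end DifferentialIdeals

namespace Polynomial

variable {K : Type*} [Field K]

theorem natDegree_derivative_sub_mul [CharZero K] {a q : K[X]} (ha : 1 ≤ a.natDegree)
    (hq : q ≠ 0) {r : K} (hr : r ≠ 0) :
    (derivative q - C r * a * q).natDegree = a.natDegree + q.natDegree := by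
  have ha0 : a ≠ 0 := by
    rintro rfl
    simp at ha
  have h : (C r * a * q).natDegree = a.natDegree + q.natDegree := by
    rw [mul_assoc, natDegree_C_mul hr, natDegree_mul ha0 hq]
  rw [natDegree_sub_eq_right_of_natDegree_lt, h]
  rw [h]
  have := natDegree_derivative_le q
  omega

/-- The recursion satisfied by the coefficients, from the top one downwards, of a Darboux
polynomial that is monic in `y` has no polynomial solution. -/
theorem not_exists_darboux_coeffs [CharZero K] {a l : K[X]} (ha : 1 ≤ a.natDegree) {n : ℕ}
    (hn : 1 ≤ n) (q : ℕ → K[X]) (s : K) (b e : ℕ → K) (he : e 0 ≠ 0)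
    (hq0 : q 0 = 1) (hqn : q (n + 1) = 0)
    (hl : l = derivative (q 1) - a * q 1 + C s)
    (hrec : ∀ k < n, derivative (q (k + 2)) - C (k + 2 : K) * a * q (k + 2) +
      (C (b k) - l) * q (k + 1) + C (e k) * q k = 0) : False := by
  have hk2 : ∀ k : ℕ, (k + 2 : K) ≠ 0 := fun k => by exact_mod_cast (k + 1).succ_ne_zero
  by_cases hq1 : q 1 = 0
  · have h := hrec 0 hn
    simp only [zero_add, hq1, hq0, mul_zero, add_zero, mul_one] at h
    have h' := eq_neg_of_add_eq_zero_left h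
    have hq2 : q 2 ≠ 0 := by
      intro h2
      simp [h2, he] at h'
    have h3 := natDegree_derivative_sub_mul ha hq2 (hk2 0)
    rw [h', natDegree_neg, natDegree_C] at h3
    omega
  · have hldeg : l.natDegree = a.natDegree + (q 1).natDegree := by
      rw [hl, natDegree_add_C]
      simpa using natDegree_derivative_sub_mul ha hq1 (one_ne_zero (α := K))
    have key : ∀ k ≤ n, (q k).natDegree = k * (q 1).natDegree ∧ q (k + 1) ≠ 0 ∧
        (q (k + 1)).natDegree = (k + 1) * (q 1).natDegree := by
      intro k
      induction k with
      | zero => simp [hq0, hq1]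
      | succ k ih =>
        intro hk
        obtain ⟨hd0, hne, hd1⟩ := ih (by omega)
        refine ⟨hd1, ?_⟩
        have h : derivative (q (k + 2)) - C (k + 2 : K) * a * q (k + 2) =
            (l - C (b k)) * q (k + 1) - C (e k) * q k := by
          linear_combination hrec k hk
        have hlb : (l - C (b k)).natDegree = a.natDegree + (q 1).natDegree := by
          rw [natDegree_sub_C, hldeg]
        have hlb0 : l - C (b k) ≠ 0 := by
          intro h0
          rw [h0, natDegree_zero] at hlb
          omega
        have hmul : ((l - C (b k)) * q (k + 1)).natDegree =
            a.natDegree + (k + 2) * (q 1).natDegree := by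
          rw [natDegree_mul hlb0 hne, hlb, hd1]
          ring
        have hrhs : ((l - C (b k)) * q (k + 1) - C (e k) * q k).natDegree =
            a.natDegree + (k + 2) * (q 1).natDegree := by
          rw [natDegree_sub_eq_left_of_natDegree_lt, hmul]
          refine (natDegree_C_mul_le _ _).trans_lt ?_
          rw [hmul, hd0]
          nlinarith
        rw [← h] at hrhs
        have hne2 : q (k + 2) ≠ 0 := by
          intro h0
          simp only [h0, derivative_zero, mul_zero, sub_zero, natDegree_zero] at hrhs
          omega
        rw [natDegree_derivative_sub_mul ha hne2 (hk2 k)] at hrhs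
        refine ⟨hne2, ?_⟩
        change (q (k + 2)).natDegree = _
        linarith
    exact (key n le_rfl).2.1 hqn

/-- Over a domain, a nonzero element of least degree of an ideal divides every element of the ideal
up to a nonzero constant factor. -/
theorem exists_dvd_C_mul_of_natDegree_le {A : Type*} [CommRing A] [IsDomain A] {I : Ideal A[X]} {f : A[X]}
    (hf : f ∈ I) (hf0 : f ≠ 0) (hmin : ∀ g ∈ I, g ≠ 0 → f.natDegree ≤ g.natDegree) :
    ∀ g ∈ I, ∃ p : A, p ≠ 0 ∧ f ∣ C p * g := by
  intro g hg
  induction hN : g.natDegree using Nat.strong_induction_on generalizing g with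
  | _ N ih =>
    by_cases hg0 : g = 0
    · exact ⟨1, one_ne_zero, by simp [hg0]⟩
    have hlef : f.leadingCoeff ≠ 0 := leadingCoeff_ne_zero.mpr hf0
    have hle := hmin g hg hg0
    obtain ⟨h, hh⟩ : ∃ h, h = C f.leadingCoeff * g -
        C g.leadingCoeff * X ^ (g.natDegree - f.natDegree) * f := ⟨_, rfl⟩
    have hhI : h ∈ I := hh ▸ I.sub_mem (I.mul_mem_left _ hg) (I.mul_mem_left _ hf)
    by_cases hh0 : h = 0
    · exact ⟨_, hlef, ⟨_, (sub_eq_zero.mp (hh ▸ hh0)).trans (mul_comm _ _)⟩⟩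
    have hlt : h.natDegree < N := by
      rw [← hN]
      refine natDegree_lt_natDegree hh0 ?_
      rw [hh, ← degree_C_mul (p := g) hlef]
      refine degree_sub_lt_left ?_ (mul_ne_zero (C_ne_zero.mpr hlef) hg0) ?_
      · rw [degree_mul, degree_mul, degree_mul, degree_C hlef, degree_X_pow,
          degree_C (leadingCoeff_ne_zero.mpr hg0), degree_eq_natDegree hg0, degree_eq_natDegree hf0]
        norm_cast
        omega
      · simp only [leadingCoeff_mul, leadingCoeff_C, leadingCoeff_X_pow, mul_one]
        ring
    obtain ⟨p, hp, u, hu⟩ := ih _ hlt h hhI rfl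
    refine ⟨p * f.leadingCoeff, mul_ne_zero hp hlef,
      u + C p * C g.leadingCoeff * X ^ (g.natDegree - f.natDegree), ?_⟩
    rw [C_mul]
    linear_combination hu - C p * hh

section RiccatiDerivation

variable {a : K[X]} {a1 c : K} {D : Derivation K K[X][X] K[X][X]}

theorem derivation_C_eq (hDx : D (C X) = X) (p : K[X]) : D (C p) = C (derivative p) * X := by
  induction p using Polynomial.induction_on' with
  | add p q hp hq => simp [hp, hq, add_mul]
  | monomial n r =>
    have h : (C (monomial n r) : K[X][X]) = r • (C X : K[X][X]) ^ n := by
      rw [← C_pow, smul_C, ← C_mul_X_pow_eq_monomial, smul_eq_C_mul]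
    rw [h, D.map_smul, D.leibniz_pow, hDx, derivative_monomial, ← C_mul_X_pow_eq_monomial]
    simp [Algebra.smul_def]
    ring

theorem derivation_monomial_succ (hDx : D (C X) = X)
    (hDy : D X = C a * X ^ 2 + C (C a1) * X + C (C c)) (n : ℕ) (p : K[X]) :
    D (monomial (n + 1) p) = C (derivative p + C (n + 1 : K) * a * p) * X ^ (n + 2) +
      C (C ((n + 1) * a1) * p) * X ^ (n + 1) + C (C ((n + 1) * c) * p) * X ^ n := by
  rw [← C_mul_X_pow_eq_monomial, D.leibniz, D.leibniz_pow, hDy, derivation_C_eq hDx]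
  simp
  ring

theorem coeff_zero_derivation (hDx : D (C X) = X)
    (hDy : D X = C a * X ^ 2 + C (C a1) * X + C (C c)) (f : K[X][X]) :
    (D f).coeff 0 = C c * f.coeff 1 := by
  induction f using Polynomial.induction_on' with
  | add p q hp hq => simp [hp, hq, mul_add]
  | monomial n p =>
    rcases n with _ | n
    · rw [monomial_zero_left, derivation_C_eq hDx, coeff_C_mul, coeff_X_zero]
      simp
    · rw [derivation_monomial_succ hDx hDy]
      simp only [coeff_add, coeff_C_mul, coeff_X_pow, coeff_monomial]
      rcases n with _ | n <;> simp

theorem coeff_succ_derivation (hDx : D (C X) = X)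
    (hDy : D X = C a * X ^ 2 + C (C a1) * X + C (C c)) (f : K[X][X]) (k : ℕ) :
    (D f).coeff (k + 1) = derivative (f.coeff k) + C (k : K) * a * f.coeff k +
      C ((k + 1) * a1) * f.coeff (k + 1) + C ((k + 2) * c) * f.coeff (k + 2) := by
  induction f using Polynomial.induction_on' with
  | add p q hp hq =>
    simp only [map_add, coeff_add, hp, hq]
    ring
  | monomial n p =>
    rcases n with _ | n
    · rw [monomial_zero_left, derivation_C_eq hDx, coeff_C_mul, coeff_X, coeff_C]
      rcases k with _ | k <;> simp
    · rw [derivation_monomial_succ hDx hDy]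
      simp only [coeff_add, coeff_C_mul, coeff_X_pow, coeff_monomial]
      by_cases h1 : k = n + 1
      · subst h1
        simp [show ¬ n + 1 + 1 = n by omega]
      by_cases h2 : k = n
      · subst h2
        simp
      by_cases h3 : k + 1 = n
      · subst h3
        have h4 : (C (2 : K) : K[X]) = 2 := map_ofNat C 2
        simp [show ¬ k + 1 + 1 = k by omega, h4]
        ring_nf
        simp
      · simp [h1, h2, h3, Ne.symm h1, Ne.symm h2, Ne.symm h3]

/-- The cofactor of a Darboux polynomial has degree at most one in `y`; comparing coefficients. -/
theorem exists_cofactor (hDx : D (C X) = X)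
    (hDy : D X = C a * X ^ 2 + C (C a1) * X + C (C c)) {f : K[X][X]} (hf : f ≠ 0)
    (hdvd : f ∣ D f) : ∃ l₁ l : K[X], C c * f.coeff 1 = l * f.coeff 0 ∧
      ∀ k : ℕ, derivative (f.coeff k) + C (k : K) * a * f.coeff k +
        C ((k + 1) * a1) * f.coeff (k + 1) + C ((k + 2) * c) * f.coeff (k + 2) =
        l₁ * f.coeff k + l * f.coeff (k + 1) := by
  obtain ⟨u, hu⟩ := hdvd
  have hu1 : u.natDegree ≤ 1 := by
    by_cases hu0 : u = 0
    · simp [hu0]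
    have h1 : (D f).natDegree ≤ f.natDegree + 1 := by
      rw [natDegree_le_iff_coeff_eq_zero]
      rintro (_ | k) hk
      · omega
      · rw [coeff_succ_derivation hDx hDy, coeff_eq_zero_of_natDegree_lt (n := k) (by omega),
          coeff_eq_zero_of_natDegree_lt (n := k + 1) (by omega),
          coeff_eq_zero_of_natDegree_lt (n := k + 2) (by omega)]
        simp
    rw [hu, natDegree_mul hf hu0] at h1
    omega
  obtain ⟨l₁, l, rfl⟩ := exists_eq_X_add_C_of_natDegree_le_one hu1
  refine ⟨l₁, l, ?_, fun k => ?_⟩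
  · rw [← coeff_zero_derivation hDx hDy, hu]
    simp only [mul_coeff_zero, coeff_add, coeff_C_zero, coeff_X_zero]
    ring
  · rw [← coeff_succ_derivation hDx hDy, hu, mul_add, ← mul_assoc, coeff_add, coeff_mul_X,
      coeff_mul_C, coeff_mul_C]
    ring

theorem derivative_leadingCoeff_of_dvd_derivation [CharZero K] (hDx : D (C X) = X)
    (hDy : D X = C a * X ^ 2 + C (C a1) * X + C (C c)) {f : K[X][X]} (hf : f ≠ 0)
    (hdvd : f ∣ D f) : derivative f.leadingCoeff = 0 := by
  obtain ⟨l₁, l, -, h⟩ := exists_cofactor hDx hDy hf hdvd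
  have h := h f.natDegree
  rw [coeff_eq_zero_of_natDegree_lt (n := f.natDegree + 1) (by omega),
    coeff_eq_zero_of_natDegree_lt (n := f.natDegree + 2) (by omega)] at h
  refine dvd_derivative_iff.mp ⟨l₁ - C (f.natDegree : K) * a, ?_⟩
  rw [leadingCoeff]
  linear_combination h

theorem not_dvd_derivation_of_monic [CharZero K] (ha : 1 ≤ a.natDegree) (hc : c ≠ 0)
    (hDx : D (C X) = X) (hDy : D X = C a * X ^ 2 + C (C a1) * X + C (C c)) {f : K[X][X]}
    (hf : f.Monic) (hn : 1 ≤ f.natDegree) : ¬ f ∣ D f := by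
  intro hdvd
  obtain ⟨n, hfn⟩ : ∃ n, f.natDegree = n := ⟨_, rfl⟩
  obtain ⟨l₁, l, hcoeff0, hcoeff⟩ := exists_cofactor hDx hDy hf.ne_zero hdvd
  have htop : f.coeff n = 1 := by
    rw [← hfn]
    exact hf
  have hsucc : f.coeff (n + 1) = 0 := coeff_eq_zero_of_natDegree_lt (by omega)
  have hsucc2 : f.coeff (n + 2) = 0 := coeff_eq_zero_of_natDegree_lt (by omega)
  have hl₁ : l₁ = C (n : K) * a := by
    have h := hcoeff n
    rw [htop, hsucc, hsucc2] at h
    simpa using h.symm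
  subst hl₁
  rw [hfn] at hn
  refine not_exists_darboux_coeffs (l := l) ha hn (fun j => if j ≤ n then f.coeff (n - j) else 0)
    (n * a1) (fun k => (n - k - 1) * a1) (fun k => (n - k) * c) ?_ ?_ ?_ ?_ ?_
  · simpa [hc] using (by omega : n ≠ 0)
  · simpa using htop
  · simp
  · obtain ⟨m, rfl⟩ := Nat.exists_eq_add_of_le' hn
    have h := hcoeff m
    rw [htop, hsucc] at h
    simp at h ⊢
    linear_combination -h
  · intro k hk
    obtain ⟨i, rfl⟩ := Nat.exists_eq_add_of_lt hk
    rcases i with _ | i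
    · simp
      linear_combination hcoeff0
    · have h := hcoeff i
      have e1 : k + (i + 1) + 1 - (k + 2) = i := by omega
      have e2 : k + (i + 1) + 1 - (k + 1) = i + 1 := by omega
      have e3 : k + (i + 1) + 1 - k = i + 2 := by omega
      simp only [e1, e2, e3, if_pos (show k + 2 ≤ k + (i + 1) + 1 by omega),
        if_pos (show k + 1 ≤ k + (i + 1) + 1 by omega), if_pos (show k ≤ k + (i + 1) + 1 by omega)]
      have h2 : (C (2 : K) : K[X]) = 2 := map_ofNat C 2
      simp [h2] at h ⊢
      linear_combination h

theorem isSimple_of_natDegree_pos [CharZero K] (ha : 1 ≤ a.natDegree) (hc : c ≠ 0)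
    (hDx : D (C X) = X) (hDy : D X = C a * X ^ 2 + C (C a1) * X + C (C c)) : D.IsSimple := by
  by_contra hD
  obtain ⟨P, hP, hPbot, hstable⟩ := D.exists_stable_prime hD
  have hXP : X ∉ P := by
    intro hX
    have h := hstable _ hX
    rw [hDy, Ideal.add_mem_iff_right] at h
    · refine hP.ne_top (Ideal.eq_top_of_isUnit_mem _ h ?_)
      exact isUnit_C.mpr (isUnit_C.mpr hc.isUnit)
    · exact P.add_mem (P.mul_mem_left _ (P.pow_mem_of_mem hX 2 two_pos)) (P.mul_mem_left _ hX)
  have hCP : ∀ p : K[X], C p ∈ P → p = 0 := by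
    intro p hp
    by_contra hp0
    have hcomap : (P.comap (C : K[X] →+* K[X][X])).IsPrime := inferInstance
    obtain ⟨r, hr, hrp⟩ := hcomap.exists_mem_prime_of_ne_bot
      ((Submodule.ne_bot_iff _).mpr ⟨p, hp, hp0⟩)
    have h := hstable _ (Ideal.mem_comap.mp hr)
    rw [derivation_C_eq hDx] at h
    have h' : derivative r ∈ P.comap (C : K[X] →+* K[X][X]) := (hP.mem_or_mem h).resolve_right hXP
    obtain ⟨u, v, huv⟩ := hrp.irreducible.separable
    refine hcomap.ne_top ((Ideal.eq_top_iff_one _).mpr ?_)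
    rw [← huv]
    exact Ideal.add_mem _ (Ideal.mul_mem_left _ _ hr) (Ideal.mul_mem_left _ _ h')
  obtain ⟨g, ⟨hgP, hg0⟩, hgmin⟩ := exists_minimalFor_of_wellFoundedLT
    (fun g : K[X][X] => g ∈ P ∧ g ≠ 0) natDegree ((Submodule.ne_bot_iff _).mp hPbot)
  obtain ⟨f, hf, hfP, hfg⟩ : ∃ f, Prime f ∧ f ∈ P ∧ f ∣ g := by
    have hu := UniqueFactorizationMonoid.factors_prod hg0
    obtain ⟨u, hu⟩ := hu
    rw [← hu, Ideal.mul_unit_mem_iff_mem _ u.isUnit, hP.multiset_prod_mem_iff_exists_mem] at hgP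
    obtain ⟨f, hf, hfP⟩ := hgP
    exact ⟨f, UniqueFactorizationMonoid.prime_of_factor f hf, hfP,
      UniqueFactorizationMonoid.dvd_of_mem_factors hf⟩
  have hmin : ∀ h ∈ P, h ≠ 0 → f.natDegree ≤ h.natDegree := by
    intro h hh hh0
    refine (natDegree_le_of_dvd hfg hg0).trans ?_
    exact (le_total _ _).elim id (hgmin ⟨hh, hh0⟩)
  have hfdeg : 1 ≤ f.natDegree := by
    by_contra! hdeg
    rw [eq_C_of_natDegree_eq_zero (by omega : f.natDegree = 0)] at hfP
    apply hf.ne_zero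
    rw [eq_C_of_natDegree_eq_zero (by omega : f.natDegree = 0), hCP _ hfP, C_0]
  have hdvd : f ∣ D f := by
    obtain ⟨p, hp, hfp⟩ := exists_dvd_C_mul_of_natDegree_le hfP hf.ne_zero hmin _ (hstable f hfP)
    refine (hf.dvd_or_dvd hfp).resolve_left fun h => ?_
    have := natDegree_le_of_dvd h (C_ne_zero.mpr hp)
    rw [natDegree_C] at this
    omega
  obtain ⟨e, he⟩ : ∃ e, f.leadingCoeff = C e :=
    ⟨_, eq_C_of_natDegree_eq_zero (derivative_eq_zero.mp
      (derivative_leadingCoeff_of_dvd_derivation hDx hDy hf.ne_zero hdvd))⟩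
  have he0 : e ≠ 0 := by
    rintro rfl
    exact leadingCoeff_ne_zero.mpr hf.ne_zero (by simpa using he)
  refine not_dvd_derivation_of_monic ha hc hDx hDy (f := C (C e⁻¹) * f) ?_ ?_ ?_
  · rw [Monic, leadingCoeff_mul, leadingCoeff_C, he, ← C_mul, inv_mul_cancel₀ he0, C_1]
  · rwa [natDegree_C_mul (C_ne_zero.mpr (inv_ne_zero he0))]
  · have h : ∀ g : K[X][X], C (C e⁻¹) * g = e⁻¹ • g := fun g => by
      rw [Algebra.smul_def]
      rfl
    rw [h f, D.map_smul, ← h, ← h]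
    exact mul_dvd_mul_left _ hdvd

theorem isSimple_iff [CharZero K] {a0 a2 : K[X]} (hDx : D (C X) = X)
    (hDy : D X = C a2 * X ^ 2 + C (C a1) * X + C a0) :
    D.IsSimple ↔ a0.degree = 0 ∧ 1 ≤ a2.degree := by
  constructor
  · intro hD
    have ha0 : a0.degree = 0 := by
      have hstable := D.span_stable (s := {X, C a0}) (by
        rintro x (rfl | rfl)
        · rw [hDy, Ideal.mem_span_pair]
          exact ⟨C a2 * X + C (C a1), 1, by ring⟩
        · rw [derivation_C_eq hDx, Ideal.mem_span_pair]
          exact ⟨C (derivative a0), 0, by ring⟩)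
      rcases hD _ hstable with h | h
      · exact absurd ((Submodule.eq_bot_iff _).mp h X (Ideal.subset_span (by simp))) X_ne_zero
      · rw [Ideal.eq_top_iff_one, Ideal.mem_span_pair] at h
        obtain ⟨u, v, huv⟩ := h
        have h0 := congrArg (fun g => coeff g 0) huv
        simp only [coeff_add, mul_coeff_zero, coeff_X_zero, coeff_C_zero, coeff_one_zero, mul_zero,
          zero_add] at h0
        exact isUnit_iff_degree_eq_zero.mp (IsUnit.of_mul_eq_one_right _ h0)
    refine ⟨ha0, ?_⟩
    by_contra! ha2
    obtain ⟨c, rfl⟩ : ∃ c, a0 = C c := ⟨_, eq_C_of_degree_le_zero ha0.le⟩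
    obtain ⟨b, rfl⟩ : ∃ b, a2 = C b :=
      ⟨_, eq_C_of_natDegree_eq_zero (by
        by_contra h
        exact ha2.not_ge (by
          rw [degree_eq_natDegree (by rintro rfl; simp at h)]
          exact_mod_cast Nat.one_le_iff_ne_zero.mpr h))⟩
    have hc : c ≠ 0 := by
      rintro rfl
      simp at ha0
    have hunit : ∀ {g : K[X][X]} {k : ℕ}, IsUnit g → 1 ≤ k → g.coeff k = 0 := by
      intro g k hg hk
      exact coeff_eq_zero_of_natDegree_lt (by rw [natDegree_eq_zero_of_isUnit hg]; omega)
    have hDC : ∀ r : K, D (C (C r)) = 0 := fun r => by simp [derivation_C_eq hDx]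
    have hD2 : D (X ^ 2) = 2 * X * D X := by simp [D.leibniz_pow, mul_assoc]
    have hdvd : D X ∣ D (D X) := by
      refine ⟨2 * C (C b) * X + C (C a1), ?_⟩
      nth_rw 1 [hDy]
      simp only [map_add, D.leibniz, hDC, hD2, smul_eq_mul]
      ring
    have hcoeff : (D X).coeff 0 = C c ∧ (D X).coeff 1 = C a1 ∧ (D X).coeff 2 = C b := by
      rw [hDy]
      simp [coeff_X, coeff_C, coeff_X_pow, mul_coeff_zero]
    rcases hD.eq_zero_or_isUnit hdvd with h | h
    · exact hc (by simpa [h] using hcoeff.1.symm)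
    · have hb : b = 0 := by simpa [hcoeff] using hunit h one_le_two
      have ha1 : a1 = 0 := by simpa [hcoeff] using hunit h le_rfl
      subst hb ha1
      have hg : D (X ^ 2 - 2 * C (C c) * C X) = 0 := by
        have h2 : D 2 = 0 := by exact_mod_cast D.map_natCast 2
        rw [map_sub, hD2, hDy]
        simp only [D.leibniz, hDC, hDx, h2, smul_eq_mul, map_zero]
        ring
      have hg2 : (X ^ 2 - 2 * C (C c) * C X : K[X][X]).coeff 2 = 1 := by
        have h2 : (2 : K[X][X]) = C 2 := rfl
        rw [h2, ← C_mul, ← C_mul, coeff_sub, coeff_X_pow, coeff_C]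
        simp
      rcases hD.eq_zero_or_isUnit (hg ▸ dvd_zero _) with h | h
      · simp [h] at hg2
      · exact one_ne_zero (hg2.symm.trans (hunit h one_le_two))
  · rintro ⟨ha0, ha2⟩
    obtain ⟨c, rfl⟩ : ∃ c, a0 = C c := ⟨_, eq_C_of_degree_le_zero ha0.le⟩
    have hc : c ≠ 0 := by
      rintro rfl
      simp at ha0
    refine isSimple_of_natDegree_pos ?_ hc hDx hDy
    exact Nat.cast_le.mp (ha2.trans degree_le_natDegree)

end RiccatiDerivation

end Polynomial

/-- The derivation of `S` transported from `R` along an isomorphism. -/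
def Derivation.transport {K R S : Type*} [Field K] [CommRing R] [Algebra K R] [CommRing S]
    [Algebra K S] (e : R ≃ₐ[K] S) (D : Derivation K R R) : Derivation K S S :=
  Derivation.mk' (e.toLinearMap ∘ₗ D.toLinearMap ∘ₗ e.symm.toLinearMap) (by
    intro a b
    simp)

theorem Derivation.transport_apply {K R S : Type*} [Field K] [CommRing R] [Algebra K R]
    [CommRing S] [Algebra K S] (e : R ≃ₐ[K] S) (D : Derivation K R R) (x : R) :
    D.transport e (e x) = e (D x) := by
  change e (D (e.symm (e x))) = _
  rw [e.symm_apply_apply]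

theorem Derivation.isSimple_transport {K R S : Type*} [Field K] [CommRing R] [Algebra K R]
    [CommRing S] [Algebra K S] (e : R ≃ₐ[K] S) (D : Derivation K R R) :
    (D.transport e).IsSimple ↔ D.IsSimple := by
  refine ⟨fun h => h.of_ringEquiv e.symm.toRingEquiv fun a => ?_,
    fun h => h.of_ringEquiv e.toRingEquiv fun a => (D.transport_apply e a).symm⟩
  obtain ⟨x, rfl⟩ := e.surjective a
  rw [D.transport_apply]
  simp

theorem stmt_8 (K : Type*) [Field K] [CharZero K] (a1 : K) (a0 a2 : Polynomial K)
    (D : Derivation K (MvPolynomial (Fin 2) K) (MvPolynomial (Fin 2) K))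
    (hDx : D (MvPolynomial.X 0) = MvPolynomial.X 1)
    (hDy : D (MvPolynomial.X 1) =
      Polynomial.aeval (MvPolynomial.X 0) a2 * MvPolynomial.X 1 ^ 2 +
        MvPolynomial.C a1 * MvPolynomial.X 1 +
        Polynomial.aeval (MvPolynomial.X 0) a0) :
    D.IsSimple ↔ a0.degree = 0 ∧ 1 ≤ a2.degree := by
  let e := (Polynomial.Bivariate.equivMvPolynomial K).symm
  have h0 : e (MvPolynomial.X 0) = Polynomial.C Polynomial.X := by simp [e]
  have h1 : e (MvPolynomial.X 1) = Polynomial.X := by simp [e]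
  have hC : e (MvPolynomial.C a1) = Polynomial.C (Polynomial.C a1) := by simp [e]
  have hp : ∀ p : Polynomial K, e (Polynomial.aeval (MvPolynomial.X 0) p) = Polynomial.C p := by
    intro p
    rw [← Polynomial.aeval_algHom_apply, h0]
    have h := Polynomial.aeval_algHom_apply (Polynomial.CAlgHom (R := K) (A := Polynomial K))
      Polynomial.X p
    simpa using h
  rw [← D.isSimple_transport e]
  refine Polynomial.isSimple_iff (a1 := a1) ?_ ?_
  · rw [← h0, D.transport_apply, hDx, h1]
  · nth_rw 1 [← h1]
    rw [D.transport_apply, hDy]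
    simp only [map_add, map_mul, map_pow, hp, h1, hC]
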